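/- Let f(x,y,z) = (x, y, Q₁(x,y,z), Q₂(x,y,z), Q₃(x,y,z)) where Q₁, Q₂, Q₃ are homogeneous quadratic polynomials, and let α be the 3×3 real matrix whose i-th row consists of the coefficients of z², xz and yz in Qᵢ. Then f is A²-equivalent to g₂(x,y,z) = (x,y,z²,xz,0) if and only if det α = 0, the rank of α equals 2, and the column of z²-coefficients of α (its first column) is nonzero. -/

import Mathlib

noncomputable section

/-- Two smooth map germs `(ℝ³,0) → (ℝ⁵,0)` are `𝒜²`-equivalent: there are smooth
changes of coordinates in source and target, fixing the origin and with invertible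
differential at the origin, such that the composites have the same 2-jet at `0`. -/
def A2Equiv (f g : (Fin 3 → ℝ) → (Fin 5 → ℝ)) : Prop :=
  ∃ (ψ : (Fin 3 → ℝ) → (Fin 3 → ℝ)) (φ : (Fin 5 → ℝ) → (Fin 5 → ℝ))
    (ψ' : (Fin 3 → ℝ) ≃L[ℝ] (Fin 3 → ℝ)) (φ' : (Fin 5 → ℝ) ≃L[ℝ] (Fin 5 → ℝ)),
    ContDiff ℝ (⊤ : ℕ∞) ψ ∧ ContDiff ℝ (⊤ : ℕ∞) φ ∧ ψ 0 = 0 ∧ φ 0 = 0 ∧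
    HasFDerivAt ψ (ψ' : (Fin 3 → ℝ) →L[ℝ] (Fin 3 → ℝ)) 0 ∧
    HasFDerivAt φ (φ' : (Fin 5 → ℝ) →L[ℝ] (Fin 5 → ℝ)) 0 ∧
    ∀ k : ℕ, k ≤ 2 → iteratedFDeriv ℝ k (φ ∘ f ∘ ψ) 0 = iteratedFDeriv ℝ k g 0

def g1 : (Fin 3 → ℝ) → (Fin 5 → ℝ) := fun p => ![p 0, p 1, p 0 * p 2, p 1 * p 2, p 2 ^ 2]
def g2 : (Fin 3 → ℝ) → (Fin 5 → ℝ) := fun p => ![p 0, p 1, p 2 ^ 2, p 0 * p 2, 0]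
def g3 : (Fin 3 → ℝ) → (Fin 5 → ℝ) := fun p => ![p 0, p 1, p 0 * p 2, p 1 * p 2, 0]
def g4 : (Fin 3 → ℝ) → (Fin 5 → ℝ) := fun p => ![p 0, p 1, p 2 ^ 2, 0, 0]
def g5 : (Fin 3 → ℝ) → (Fin 5 → ℝ) := fun p => ![p 0, p 1, p 0 * p 2, 0, 0]
def g6 : (Fin 3 → ℝ) → (Fin 5 → ℝ) := fun p => ![p 0, p 1, 0, 0, 0]

open scoped Matrix

theorem fderiv_fderiv_comp_apply {E F G : Type*} [NormedAddCommGroup E] [NormedSpace ℝ E]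
    [NormedAddCommGroup F] [NormedSpace ℝ F] [NormedAddCommGroup G] [NormedSpace ℝ G]
    {φ : F → G} {f : E → F} (hφ : ContDiff ℝ 2 φ) (hf : ContDiff ℝ 2 f) (x u v : E) :
    fderiv ℝ (fderiv ℝ (φ ∘ f)) x u v =
      fderiv ℝ (fderiv ℝ φ) (f x) (fderiv ℝ f x u) (fderiv ℝ f x v) +
        fderiv ℝ φ (f x) (fderiv ℝ (fderiv ℝ f) x u v) := by
  have hφd := hφ.differentiable (by norm_num)
  have hfd := hf.differentiable (by norm_num)
  have hφ' := (hφ.fderiv_right (m := 1) (by norm_num)).differentiable (by norm_num)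
  have hf' := (hf.fderiv_right (m := 1) (by norm_num)).differentiable (by norm_num)
  have h : fderiv ℝ (φ ∘ f) = fun y => (fderiv ℝ φ (f y)).comp (fderiv ℝ f y) := by
    funext y
    exact fderiv_comp y (hφd _) (hfd _)
  rw [h]
  have h1 := ((hφ' (f x)).hasFDerivAt.comp x (hfd x).hasFDerivAt).clm_comp (hf' x).hasFDerivAt
  have h2 := h1.fderiv
  simp only [Function.comp_def] at h2
  rw [h2]
  simp [add_comm]

/-- The polynomial of degree two in three variables, without constant term, with linear
coefficients `l` and quadratic coefficients `k`. -/
def quadPoly (l : Fin 3 → ℝ) (k : Fin 6 → ℝ) (p : Fin 3 → ℝ) : ℝ :=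
  l 0 * p 0 + l 1 * p 1 + l 2 * p 2 + (k 0 * p 0 ^ 2 + k 1 * p 0 * p 1 + k 2 * p 1 ^ 2
    + k 3 * p 2 ^ 2 + k 4 * p 0 * p 2 + k 5 * p 1 * p 2)

theorem contDiff_quadPoly (l : Fin 3 → ℝ) (k : Fin 6 → ℝ) {n : WithTop ℕ∞} :
    ContDiff ℝ n (quadPoly l k) := by
  unfold quadPoly; fun_prop

theorem fderiv_quadPoly (l : Fin 3 → ℝ) (k : Fin 6 → ℝ) (x v : Fin 3 → ℝ) :
    fderiv ℝ (quadPoly l k) x v =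
      quadPoly ![2 * k 0 * v 0 + k 1 * v 1 + k 4 * v 2, k 1 * v 0 + 2 * k 2 * v 1 + k 5 * v 2,
        k 4 * v 0 + k 5 * v 1 + 2 * k 3 * v 2] 0 x + (l 0 * v 0 + l 1 * v 1 + l 2 * v 2) := by
  have h (i : Fin 3) : HasFDerivAt (fun p : Fin 3 → ℝ => p i)
      (ContinuousLinearMap.proj (R := ℝ) (φ := fun _ : Fin 3 => ℝ) i) x := hasFDerivAt_apply i x
  have H := (((((h 0).const_mul (l 0)).add ((h 1).const_mul (l 1))).add ((h 2).const_mul (l 2))).add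
    (((((((((h 0).pow 2).const_mul (k 0)).add (((h 0).const_mul (k 1)).mul (h 1))).add
      (((h 1).pow 2).const_mul (k 2))).add (((h 2).pow 2).const_mul (k 3))).add
      (((h 0).const_mul (k 4)).mul (h 2)))).add (((h 1).const_mul (k 5)).mul (h 2))))
  have H' : HasFDerivAt (quadPoly l k) _ x := H
  rw [H'.fderiv]
  simp [quadPoly]
  ring

theorem fderiv_fderiv_quadPoly (l : Fin 3 → ℝ) (k : Fin 6 → ℝ) (x u v : Fin 3 → ℝ) :
    fderiv ℝ (fderiv ℝ (quadPoly l k)) x u v =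
      (2 * k 0 * v 0 + k 1 * v 1 + k 4 * v 2) * u 0 +
        (k 1 * v 0 + 2 * k 2 * v 1 + k 5 * v 2) * u 1 +
        (k 4 * v 0 + k 5 * v 1 + 2 * k 3 * v 2) * u 2 := by
  have hd : DifferentiableAt ℝ (fderiv ℝ (quadPoly l k)) x :=
    ((contDiff_quadPoly l k (n := 2)).fderiv_right (m := 1) (by norm_num)).differentiable
      (by norm_num) x
  have h1 : fderiv ℝ (fderiv ℝ (quadPoly l k)) x u v =
      fderiv ℝ (fun y => fderiv ℝ (quadPoly l k) y v) x u := by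
    have := (hd.hasFDerivAt.clm_apply (hasFDerivAt_const v x)).fderiv
    rw [this]
    simp
  rw [h1]
  simp only [fderiv_quadPoly]
  rw [fderiv_add_const, fderiv_quadPoly]
  simp [quadPoly]

/-- The map with components `quadPoly (l i) (k i)`. -/
def quadMap (l : Fin 5 → Fin 3 → ℝ) (k : Fin 5 → Fin 6 → ℝ) (p : Fin 3 → ℝ) : Fin 5 → ℝ :=
  fun i => quadPoly (l i) (k i) p

theorem contDiff_quadMap (l : Fin 5 → Fin 3 → ℝ) (k : Fin 5 → Fin 6 → ℝ) {n : WithTop ℕ∞} :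
    ContDiff ℝ n (quadMap l k) :=
  contDiff_pi.2 fun i => contDiff_quadPoly (l i) (k i)

theorem fderiv_quadMap_apply (l : Fin 5 → Fin 3 → ℝ) (k : Fin 5 → Fin 6 → ℝ) (x v : Fin 3 → ℝ)
    (i : Fin 5) : fderiv ℝ (quadMap l k) x v i = fderiv ℝ (quadPoly (l i) (k i)) x v := by
  have h := (contDiff_quadMap l k (n := 1)).differentiable (by norm_num) x
  have := (hasFDerivAt_pi'.1 h.hasFDerivAt i).fderiv
  change fderiv ℝ (quadPoly (l i) (k i)) x = _ at this
  rw [this]; rfl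

theorem fderiv_fderiv_quadMap_apply (l : Fin 5 → Fin 3 → ℝ) (k : Fin 5 → Fin 6 → ℝ)
    (x u v : Fin 3 → ℝ) (i : Fin 5) :
    fderiv ℝ (fderiv ℝ (quadMap l k)) x u v i =
      fderiv ℝ (fderiv ℝ (quadPoly (l i) (k i))) x u v := by
  let R : ((Fin 3 → ℝ) →L[ℝ] (Fin 5 → ℝ)) →L[ℝ] ((Fin 3 → ℝ) →L[ℝ] ℝ) :=
    ContinuousLinearMap.compL ℝ (Fin 3 → ℝ) (Fin 5 → ℝ) ℝ
      (ContinuousLinearMap.proj (R := ℝ) (φ := fun _ : Fin 5 => ℝ) i)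
  have hd : DifferentiableAt ℝ (fderiv ℝ (quadMap l k)) x :=
    ((contDiff_quadMap l k (n := 2)).fderiv_right (m := 1) (by norm_num)).differentiable
      (by norm_num) x
  have h : fderiv ℝ (quadPoly (l i) (k i)) = R ∘ fderiv ℝ (quadMap l k) := by
    funext y
    ext1 v
    exact (fderiv_quadMap_apply l k y v i).symm
  rw [h, (R.hasFDerivAt.comp x hd.hasFDerivAt).fderiv]
  rfl

/-- First and second order consequences of `𝒜²`-equivalence: the chain rule at the origin. -/
theorem A2Equiv.exists_fderiv_eq {f g : (Fin 3 → ℝ) → (Fin 5 → ℝ)} (h : A2Equiv f g)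
    (hf : ContDiff ℝ 2 f) (hf0 : f 0 = 0) :
    ∃ (A : (Fin 3 → ℝ) ≃L[ℝ] (Fin 3 → ℝ)) (B : (Fin 5 → ℝ) ≃L[ℝ] (Fin 5 → ℝ))
      (A₂ : (Fin 3 → ℝ) →L[ℝ] (Fin 3 → ℝ) →L[ℝ] (Fin 3 → ℝ))
      (B₂ : (Fin 5 → ℝ) →L[ℝ] (Fin 5 → ℝ) →L[ℝ] (Fin 5 → ℝ)),
      (∀ u, fderiv ℝ g 0 u = B (fderiv ℝ f 0 (A u))) ∧
      ∀ u v, fderiv ℝ (fderiv ℝ g) 0 u v =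
        B₂ (fderiv ℝ f 0 (A u)) (fderiv ℝ f 0 (A v)) +
          B (fderiv ℝ (fderiv ℝ f) 0 (A u) (A v) + fderiv ℝ f 0 (A₂ u v)) := by
  obtain ⟨ψ, φ, A, B, hψ, hφ, hψ0, hφ0, hA, hB, hk⟩ := h
  have hψ2 : ContDiff ℝ 2 ψ := contDiff_infty.1 hψ 2
  have hφ2 : ContDiff ℝ 2 φ := contDiff_infty.1 hφ 2
  have hfd : DifferentiableAt ℝ f 0 := hf.differentiable (by norm_num) 0
  have hfψ : HasFDerivAt (f ∘ ψ) ((fderiv ℝ f 0).comp (A : (Fin 3 → ℝ) →L[ℝ] (Fin 3 → ℝ))) 0 := by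
    refine HasFDerivAt.comp 0 ?_ hA
    rw [hψ0]
    exact hfd.hasFDerivAt
  have hfψ0 : (f ∘ ψ) 0 = 0 := by simp [hψ0, hf0]
  refine ⟨A, B, fderiv ℝ (fderiv ℝ ψ) 0, fderiv ℝ (fderiv ℝ φ) 0, fun u => ?_, fun u v => ?_⟩
  · have h1 := congrArg (fun m => m (fun _ => u)) (hk 1 (by norm_num))
    simp only [iteratedFDeriv_one_apply] at h1
    rw [← h1]
    have : HasFDerivAt (φ ∘ (f ∘ ψ)) _ 0 :=
      HasFDerivAt.comp 0 (by rw [hfψ0]; exact hB) hfψ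
    rw [this.fderiv]
    rfl
  · have h2 := congrArg (fun m => m ![u, v]) (hk 2 le_rfl)
    simp only [iteratedFDeriv_two_apply] at h2
    simp only [Matrix.cons_val_zero, Matrix.cons_val_one] at h2
    rw [← h2, fderiv_fderiv_comp_apply hφ2 (hf.comp hψ2), fderiv_fderiv_comp_apply hf hψ2, hfψ0,
      hψ0, hfψ.fderiv, hB.fderiv, hA.fderiv]
    rfl

/-- The map `(x, y, Q₁, Q₂, Q₃)` with `Qᵢ` having coefficients `K i`. -/
def mongeMap (K : Fin 3 → Fin 6 → ℝ) : (Fin 3 → ℝ) → (Fin 5 → ℝ) :=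
  quadMap ![![1, 0, 0], ![0, 1, 0], 0, 0, 0] ![0, 0, K 0, K 1, K 2]

theorem mongeMap_zero (K : Fin 3 → Fin 6 → ℝ) : mongeMap K 0 = 0 := by
  funext i
  simp [mongeMap, quadMap, quadPoly]

theorem fderiv_mongeMap_zero (K : Fin 3 → Fin 6 → ℝ) (v : Fin 3 → ℝ) :
    fderiv ℝ (mongeMap K) 0 v = ![v 0, v 1, 0, 0, 0] := by
  funext i
  rw [mongeMap, fderiv_quadMap_apply, fderiv_quadPoly]
  fin_cases i <;> simp [quadPoly]

theorem fderiv_fderiv_mongeMap_zero (K : Fin 3 → Fin 6 → ℝ) (u : Fin 3 → ℝ) (t : ℝ) :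
    fderiv ℝ (fderiv ℝ (mongeMap K)) 0 u ![0, 0, t] =
      ![0, 0, t * (K 0 3 * (2 * u 2) + K 0 4 * u 0 + K 0 5 * u 1),
        t * (K 1 3 * (2 * u 2) + K 1 4 * u 0 + K 1 5 * u 1),
        t * (K 2 3 * (2 * u 2) + K 2 4 * u 0 + K 2 5 * u 1)] := by
  funext i
  rw [mongeMap, fderiv_fderiv_quadMap_apply, fderiv_fderiv_quadPoly]
  fin_cases i <;> simp <;> ring

theorem g2_eq_mongeMap :
    g2 = mongeMap ![![0, 0, 0, 1, 0, 0], ![0, 0, 0, 0, 1, 0], 0] := by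
  funext p i
  fin_cases i <;> simp [g2, mongeMap, quadMap, quadPoly]

/-- The second intrinsic derivative: an `𝒜²`-equivalence of a map in Monge form with `g2`
carries the coefficient matrix of `z², xz, yz` to that of `g2`, up to a linear map `M` induced
on the cokernel. -/
theorem A2Equiv.exists_mulVec_eq {K : Fin 3 → Fin 6 → ℝ} (h : A2Equiv (mongeMap K) g2)
    (α : Matrix (Fin 3) (Fin 3) ℝ) (hα : ∀ i, ![K i 3, K i 4, K i 5] = α i) :
    ∃ (A : (Fin 3 → ℝ) ≃L[ℝ] (Fin 3 → ℝ)) (M : (Fin 3 → ℝ) →ₗ[ℝ] (Fin 3 → ℝ)) (t : ℝ),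
      Function.Surjective M ∧ A ![0, 0, 1] = ![0, 0, t] ∧
      ∀ u, M (t • α *ᵥ ![2 * A u 2, A u 0, A u 1]) = ![2 * u 2, u 0, 0] := by
  obtain ⟨A, B, A₂, B₂, h1, h2⟩ := h.exists_fderiv_eq (contDiff_quadMap _ _) (mongeMap_zero K)
  rw [g2_eq_mongeMap] at h1 h2
  simp only [fderiv_mongeMap_zero] at h1 h2
  have hB (a b : ℝ) (j : Fin 3) : B ![a, b, 0, 0, 0] (Fin.natAdd 2 j) = 0 := by
    obtain ⟨u, hu⟩ := A.surjective ![a, b, 0]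
    have := h1 u
    rw [hu] at this
    simp only [Matrix.cons_val_zero, Matrix.cons_val_one] at this
    rw [← this]
    fin_cases j <;> rfl
  let e : Fin 3 → ℝ := ![0, 0, 1]
  have hAe : A e = ![0, 0, A e 2] := by
    have := h1 e
    have h0 : (![e 0, e 1, 0, 0, 0] : Fin 5 → ℝ) = 0 := by
      funext i; fin_cases i <;> simp [e]
    rw [h0, eq_comm, map_eq_zero_iff B B.injective] at this
    funext i
    fin_cases i
    · simpa using congrFun this 0
    · simpa using congrFun this 1
    · rfl
  let ι : (Fin 3 → ℝ) →ₗ[ℝ] (Fin 5 → ℝ) :=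
    { toFun := fun v => ![0, 0, v 0, v 1, v 2]
      map_add' := fun v w => by funext i; fin_cases i <;> simp
      map_smul' := fun r v => by funext i; fin_cases i <;> simp }
  have hsplit (w : Fin 5 → ℝ) (j : Fin 3) :
      B w (Fin.natAdd 2 j) = B (ι ![w 2, w 3, w 4]) (Fin.natAdd 2 j) := by
    have : w = ![w 0, w 1, 0, 0, 0] + ι ![w 2, w 3, w 4] := by
      funext i; fin_cases i <;> simp [ι]
    conv_lhs => rw [this, map_add, Pi.add_apply, hB, zero_add]
  refine ⟨A, LinearMap.funLeft ℝ ℝ (Fin.natAdd 2) ∘ₗ B.toLinearMap ∘ₗ ι, A e 2, fun w => ?_, hAe,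
    fun u => ?_⟩
  · obtain ⟨y, hy⟩ := B.surjective ![0, 0, w 0, w 1, w 2]
    refine ⟨![y 2, y 3, y 4], ?_⟩
    funext j
    change B (ι ![y 2, y 3, y 4]) (Fin.natAdd 2 j) = w j
    rw [← hsplit, hy]
    fin_cases j <;> rfl
  · have h3 := h2 u e
    have h0 : (![A e 0, A e 1, 0, 0, 0] : Fin 5 → ℝ) = 0 := by
      rw [hAe]; funext i; fin_cases i <;> simp
    rw [h0, map_zero, zero_add, hAe, fderiv_fderiv_mongeMap_zero, map_add] at h3
    funext j
    have h4 := congrFun h3 (Fin.natAdd 2 j)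
    rw [Pi.add_apply, hB, add_zero, fderiv_fderiv_mongeMap_zero] at h4
    change B (ι _) (Fin.natAdd 2 j) = _
    have hι : ι (A e 2 • α *ᵥ ![2 * A u 2, A u 0, A u 1]) =
      ![0, 0, A e 2 * (K 0 3 * (2 * A u 2) + K 0 4 * A u 0 + K 0 5 * A u 1),
        A e 2 * (K 1 3 * (2 * A u 2) + K 1 4 * A u 0 + K 1 5 * A u 1),
        A e 2 * (K 2 3 * (2 * A u 2) + K 2 4 * A u 0 + K 2 5 * A u 1)] := by
      funext i
      fin_cases i <;> simp [ι, Matrix.mulVec, dotProduct, Fin.sum_univ_three, ← hα]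
    rw [hι]
    refine h4.symm.trans ?_
    fin_cases j <;> simp [Fin.natAdd]

theorem A2Equiv.det_rank_of_mongeMap {K : Fin 3 → Fin 6 → ℝ} (h : A2Equiv (mongeMap K) g2)
    (α : Matrix (Fin 3) (Fin 3) ℝ) (hα : ∀ i, ![K i 3, K i 4, K i 5] = α i) :
    α.det = 0 ∧ α.rank = 2 ∧ ∃ i, α i 0 ≠ 0 := by
  obtain ⟨A, M, t, hM, hAe, hMα⟩ := h.exists_mulVec_eq α hα
  have ht : t ≠ 0 := by
    rintro rfl
    have := congrFun (hMα ![1, 0, 0]) 1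
    simp at this
  have hdet : α.det = 0 := by
    by_contra hne
    obtain ⟨v, hv⟩ := hM ![0, 0, 1]
    have hu : IsUnit α.det := isUnit_iff_ne_zero.2 hne
    let w := α⁻¹ *ᵥ (t⁻¹ • v)
    obtain ⟨u, hu'⟩ := A.surjective ![w 1, w 2, w 0 / 2]
    have hw : (![2 * A u 2, A u 0, A u 1] : Fin 3 → ℝ) = w := by
      rw [hu']
      funext i
      fin_cases i
      · simp; ring
      · simp
      · simp
    have := hMα u
    rw [hw, Matrix.mulVec_mulVec, Matrix.mul_nonsing_inv _ hu, Matrix.one_mulVec,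
      smul_smul, mul_inv_cancel₀ ht, one_smul, hv] at this
    simpa using congrFun this 2
  refine ⟨hdet, le_antisymm ?_ ?_, ?_⟩
  · by_contra! hlt
    have h3 : α.rank = 3 := le_antisymm (by simpa using α.rank_le_card_width) hlt
    have hli : LinearIndependent ℝ α.col :=
      linearIndependent_iff_card_eq_finrank_span.2
        ((Fintype.card_fin 3).trans (h3.symm.trans α.rank_eq_finrank_span_cols))
    rw [Matrix.linearIndependent_cols_iff_isUnit, Matrix.isUnit_iff_isUnit_det, hdet] at hli
    exact not_isUnit_zero hli
  · have hr (u : Fin 3 → ℝ) : ![2 * u 2, u 0, 0] ∈ LinearMap.range (M ∘ₗ α.mulVecLin) := by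
      refine ⟨t • ![2 * A u 2, A u 0, A u 1], ?_⟩
      rw [← hMα u, LinearMap.comp_apply, Matrix.mulVecLin_apply, Matrix.mulVec_smul]
    have hli : LinearIndependent ℝ
        ![(⟨_, hr ![0, 0, 1]⟩ : LinearMap.range (M ∘ₗ α.mulVecLin)), ⟨_, hr ![1, 0, 0]⟩] := by
      rw [LinearIndependent.pair_iff]
      intro a b hab
      have hab' := congrArg Subtype.val hab
      have h0 := congrFun hab' 0
      have h1 := congrFun hab' 1
      simp at h0 h1
      exact ⟨h0, h1⟩
    have := hli.fintype_card_le_finrank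
    rw [Fintype.card_fin, LinearMap.range_comp] at this
    exact this.trans (Submodule.finrank_map_le _ _)
  · by_contra! h0
    have := congrFun (hMα ![0, 0, 1]) 0
    have hz : α *ᵥ ![2 * A ![0, 0, 1] 2, A ![0, 0, 1] 0, A ![0, 0, 1] 1] = 0 := by
      rw [hAe]
      funext i
      simp [Matrix.mulVec, dotProduct, Fin.sum_univ_three, h0]
    rw [hz] at this
    simp at this

/-- Row reduction of a singular rank two matrix with nonzero first column. -/
theorem exists_mul_eq_of_rank_eq_two (α : Matrix (Fin 3) (Fin 3) ℝ) (hdet : α.det = 0)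
    (hrank : α.rank = 2) (h0 : ∃ i, α i 0 ≠ 0) :
    ∃ (P : Matrix (Fin 3) (Fin 3) ℝ) (a b p q : ℝ), P.det ≠ 0 ∧ p ^ 2 + q ^ 2 ≠ 0 ∧
      P * α = !![1, a, b; 0, p, q; 0, 0, 0] := by
  obtain ⟨i, hi⟩ := h0
  obtain ⟨r, hr, hrα⟩ := Matrix.exists_vecMul_eq_zero_iff.2 hdet
  let s : Fin 3 → ℝ := Pi.single i (α i 0)⁻¹
  have hs0 : (s ᵥ* α) 0 = 1 := by simp [s, hi]
  obtain ⟨t, ht0, ht⟩ : ∃ t : Fin 3 → ℝ, (t ᵥ* α) 0 = 0 ∧ t ᵥ* α ≠ 0 := by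
    by_contra! hcon
    have hα : α = Matrix.vecMulVec (fun j => α j 0) (s ᵥ* α) := by
      ext j k
      have h1 : (Pi.single j 1 - α j 0 • s) ᵥ* α = 0 := by
        apply hcon
        rw [Matrix.sub_vecMul, Matrix.smul_vecMul, Pi.sub_apply, Pi.smul_apply, hs0]
        simp
      have h2 := congrFun h1 k
      rw [Matrix.sub_vecMul, Matrix.smul_vecMul, Pi.sub_apply, Pi.smul_apply] at h2
      simpa [sub_eq_zero, Matrix.vecMulVec_apply] using h2
    have := Matrix.rank_vecMulVec_le (fun j => α j 0) (s ᵥ* α)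
    rw [← hα, hrank] at this
    omega
  have hmul : Matrix.of ![s, t, r] * α =
      !![1, (s ᵥ* α) 1, (s ᵥ* α) 2; 0, (t ᵥ* α) 1, (t ᵥ* α) 2; 0, 0, 0] := by
    have hrow (j : Fin 3) : (Matrix.of ![s, t, r] * α) j = ![s, t, r] j ᵥ* α := rfl
    ext j k
    rw [hrow]
    fin_cases j
    · fin_cases k <;> simp [hs0]
    · fin_cases k <;> simp [ht0]
    · fin_cases k <;> simp [hrα]
  have hpq : (t ᵥ* α) 1 ^ 2 + (t ᵥ* α) 2 ^ 2 ≠ 0 := by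
    intro h
    obtain ⟨h1, h2⟩ := (add_eq_zero_iff_of_nonneg (sq_nonneg _) (sq_nonneg _)).1 h
    apply ht
    funext k
    fin_cases k
    · exact ht0
    · exact pow_eq_zero_iff two_ne_zero |>.1 h1
    · exact pow_eq_zero_iff two_ne_zero |>.1 h2
  refine ⟨Matrix.of ![s, t, r], _, _, _, _, fun hP => ?_, hpq, hmul⟩
  obtain ⟨w, hw, hwP⟩ := Matrix.exists_vecMul_eq_zero_iff.2 hP
  have hwα : w ᵥ* (Matrix.of ![s, t, r] * α) = 0 := by
    rw [← Matrix.vecMul_vecMul, hwP, Matrix.zero_vecMul]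
  have hsolve (a b p q : ℝ) (h : w ᵥ* !![1, a, b; 0, p, q; 0, 0, 0] = 0) :
      w 0 = 0 ∧ w 1 * p = 0 ∧ w 1 * q = 0 := by
    have h0 := congrFun h 0
    have h1 := congrFun h 1
    have h2 := congrFun h 2
    simp only [Matrix.vecMul, dotProduct, Fin.sum_univ_three, Matrix.of_apply, Matrix.cons_val,
      Pi.zero_apply, mul_one, mul_zero, add_zero] at h0 h1 h2
    rw [h0] at h1 h2
    exact ⟨h0, by simpa using h1, by simpa using h2⟩
  rw [hmul] at hwα
  obtain ⟨e0, e1, e2⟩ := hsolve _ _ _ _ hwα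
  have w1 : w 1 = 0 := by
    by_contra hne
    rw [(mul_eq_zero.1 e1).resolve_left hne, (mul_eq_zero.1 e2).resolve_left hne] at hpq
    simp at hpq
  obtain ⟨j, hj⟩ := Function.ne_iff.1 hr
  have e3 := congrFun hwP j
  simp [Matrix.vecMul, dotProduct, Fin.sum_univ_three, e0, w1] at e3
  apply hw
  funext k
  fin_cases k
  · exact e0
  · exact w1
  · exact e3.resolve_right hj

/-- The map of `ℝ⁵` with three last components binary quadratic forms in the first two
coordinates. -/
def targetQuad (e : Fin 3 → Fin 3 → ℝ) (w : Fin 5 → ℝ) : Fin 5 → ℝ :=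
  ![0, 0, e 0 0 * w 0 ^ 2 + e 0 1 * w 0 * w 1 + e 0 2 * w 1 ^ 2,
    e 1 0 * w 0 ^ 2 + e 1 1 * w 0 * w 1 + e 1 2 * w 1 ^ 2,
    e 2 0 * w 0 ^ 2 + e 2 1 * w 0 * w 1 + e 2 2 * w 1 ^ 2]

theorem contDiff_targetQuad (e : Fin 3 → Fin 3 → ℝ) {n : WithTop ℕ∞} :
    ContDiff ℝ n (targetQuad e) := by
  rw [contDiff_pi]
  intro i
  fin_cases i <;> simp [targetQuad] <;> fun_prop

theorem hasFDerivAt_targetQuad (e : Fin 3 → Fin 3 → ℝ) :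
    HasFDerivAt (targetQuad e) (0 : (Fin 5 → ℝ) →L[ℝ] (Fin 5 → ℝ)) 0 := by
  have h (i : Fin 5) : HasFDerivAt (fun p : Fin 5 → ℝ => p i)
      (ContinuousLinearMap.proj (R := ℝ) (φ := fun _ : Fin 5 => ℝ) i) 0 := hasFDerivAt_apply i 0
  have hq (k : Fin 3 → ℝ) : HasFDerivAt (fun w : Fin 5 → ℝ =>
      k 0 * w 0 ^ 2 + k 1 * w 0 * w 1 + k 2 * w 1 ^ 2) (0 : (Fin 5 → ℝ) →L[ℝ] ℝ) 0 := by
    have H := ((((h 0).pow 2).const_mul (k 0)).add (((h 0).const_mul (k 1)).mul (h 1))).add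
      (((h 1).pow 2).const_mul (k 2))
    refine HasFDerivAt.congr_fderiv H ?_
    ext
    simp
  rw [hasFDerivAt_pi']
  intro i
  rw [ContinuousLinearMap.comp_zero]
  fin_cases i
  · exact hasFDerivAt_const 0 0
  · exact hasFDerivAt_const 0 0
  · exact hq (e 0)
  · exact hq (e 1)
  · exact hq (e 2)

theorem A2Equiv.of_targetQuad {f g : (Fin 3 → ℝ) → (Fin 5 → ℝ)}
    (A : (Fin 3 → ℝ) ≃L[ℝ] (Fin 3 → ℝ)) (B : (Fin 5 → ℝ) ≃L[ℝ] (Fin 5 → ℝ))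
    (e : Fin 3 → Fin 3 → ℝ) (h : ∀ p, B (f (A p)) - targetQuad e (f (A p)) = g p) :
    A2Equiv f g := by
  refine ⟨A, fun w => B w - targetQuad e w, A, B, A.contDiff,
    B.contDiff.sub (contDiff_targetQuad e), map_zero A, ?_, A.hasFDerivAt, ?_, fun k _ => ?_⟩
  · funext i
    fin_cases i <;> simp [targetQuad]
  · simpa using B.hasFDerivAt.sub (hasFDerivAt_targetQuad e)
  · congr 1
    exact funext h

theorem A2Equiv.mongeMap_g2 {K : Fin 3 → Fin 6 → ℝ}
    (α : Matrix (Fin 3) (Fin 3) ℝ) (hα : ∀ i, ![K i 3, K i 4, K i 5] = α i)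
    (hdet : α.det = 0) (hrank : α.rank = 2) (h0 : ∃ i, α i 0 ≠ 0) :
    A2Equiv (mongeMap K) g2 := by
  obtain ⟨P, a, b, p, q, hP, hpq, hPα⟩ := exists_mul_eq_of_rank_eq_two α hdet hrank h0
  let A : (Fin 3 → ℝ) →ₗ[ℝ] (Fin 3 → ℝ) :=
    Matrix.toLin' !![p / (p ^ 2 + q ^ 2), -q / (p ^ 2 + q ^ 2), 0;
      q / (p ^ 2 + q ^ 2), p / (p ^ 2 + q ^ 2), 0;
      -(a * p + b * q) / (2 * (p ^ 2 + q ^ 2)), (a * q - b * p) / (2 * (p ^ 2 + q ^ 2)), 1]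
  let B : (Fin 5 → ℝ) →ₗ[ℝ] (Fin 5 → ℝ) :=
    Matrix.toLin' !![p, q, 0, 0, 0; -q, p, 0, 0, 0; 0, 0, P 0 0, P 0 1, P 0 2;
      0, 0, P 1 0, P 1 1, P 1 2; 0, 0, P 2 0, P 2 1, P 2 2]
  have hA (v : Fin 3 → ℝ) : A v = ![(p * v 0 - q * v 1) / (p ^ 2 + q ^ 2),
      (q * v 0 + p * v 1) / (p ^ 2 + q ^ 2),
      v 2 - (a * ((p * v 0 - q * v 1) / (p ^ 2 + q ^ 2)) +
        b * ((q * v 0 + p * v 1) / (p ^ 2 + q ^ 2))) / 2] := by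
    funext i
    fin_cases i <;> simp [A, Matrix.toLin'_apply, Matrix.mulVec, dotProduct, Fin.sum_univ_three] <;>
      field_simp <;> ring
  have hB (w : Fin 5 → ℝ) : B w = ![p * w 0 + q * w 1, -q * w 0 + p * w 1,
      P 0 0 * w 2 + P 0 1 * w 3 + P 0 2 * w 4, P 1 0 * w 2 + P 1 1 * w 3 + P 1 2 * w 4,
      P 2 0 * w 2 + P 2 1 * w 3 + P 2 2 * w 4] := by
    funext i
    fin_cases i <;> simp [B, Matrix.toLin'_apply, Matrix.mulVec, dotProduct, Fin.sum_univ_five]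
  have hrot {x y : ℝ} (h1 : p * x + q * y = 0) (h2 : -q * x + p * y = 0) : x = 0 ∧ y = 0 := by
    constructor
    · exact (mul_eq_zero.1 (by linear_combination p * h1 - q * h2 :
        (p ^ 2 + q ^ 2) * x = 0)).resolve_left hpq
    · exact (mul_eq_zero.1 (by linear_combination q * h1 + p * h2 :
        (p ^ 2 + q ^ 2) * y = 0)).resolve_left hpq
  have hAinj : Function.Injective A := by
    rw [← LinearMap.ker_eq_bot, LinearMap.ker_eq_bot']
    intro v hv
    rw [hA] at hv
    have e0 : (p * v 0 - q * v 1) / (p ^ 2 + q ^ 2) = 0 := congrFun hv 0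
    have e1 : (q * v 0 + p * v 1) / (p ^ 2 + q ^ 2) = 0 := congrFun hv 1
    have e2 := congrFun hv 2
    simp only [Matrix.cons_val, e0, e1, Pi.zero_apply] at e2
    rw [div_eq_zero_iff, or_iff_left hpq] at e0 e1
    obtain ⟨h1, h2⟩ := hrot (x := v 1) (y := v 0) (by linear_combination e1)
      (by linear_combination e0)
    funext i
    fin_cases i
    · exact h2
    · exact h1
    · simpa using e2
  have hBinj : Function.Injective B := by
    rw [← LinearMap.ker_eq_bot, LinearMap.ker_eq_bot']
    intro w hw
    rw [hB] at hw
    obtain ⟨h1, h2⟩ := hrot (congrFun hw 0) (congrFun hw 1)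
    have h3 : P *ᵥ ![w 2, w 3, w 4] = 0 := by
      funext i
      have e2 := congrFun hw 2
      have e3 := congrFun hw 3
      have e4 := congrFun hw 4
      fin_cases i <;>
        simpa [Matrix.mulVec, dotProduct, Fin.sum_univ_three] using by assumption
    have h4 := Matrix.eq_zero_of_mulVec_eq_zero hP h3
    funext i
    fin_cases i
    · exact h1
    · exact h2
    · exact congrFun h4 0
    · exact congrFun h4 1
    · exact congrFun h4 2
  let k : Fin 3 → Fin 3 → ℝ := fun i j => P i 0 * K 0 (j.castLE (by norm_num)) +
    P i 1 * K 1 (j.castLE (by norm_num)) + P i 2 * K 2 (j.castLE (by norm_num))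
  refine A2Equiv.of_targetQuad (LinearEquiv.ofInjectiveEndo A hAinj).toContinuousLinearEquiv
    (LinearEquiv.ofInjectiveEndo B hBinj).toContinuousLinearEquiv
    ![![k 0 0 - a ^ 2 / 4, k 0 1 - a * b / 2, k 0 2 - b ^ 2 / 4],
      ![k 1 0 - p * a / 2, k 1 1 - (p * b + q * a) / 2, k 1 2 - q * b / 2], k 2] fun v => ?_
  change B (mongeMap K (A v)) - targetQuad _ (mongeMap K (A v)) = g2 v
  have hentry (i j : Fin 3) : P i 0 * α 0 j + P i 1 * α 1 j + P i 2 * α 2 j =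
      !![1, a, b; 0, p, q; 0, 0, 0] i j := by
    rw [← hPα, Matrix.mul_apply, Fin.sum_univ_three]
  simp only [← hα] at hentry
  rw [hA, hB]
  set x := (p * v 0 - q * v 1) / (p ^ 2 + q ^ 2) with hx
  set y := (q * v 0 + p * v 1) / (p ^ 2 + q ^ 2) with hy
  have hX : p * x + q * y = v 0 := by rw [hx, hy]; field_simp; ring
  have hY : -q * x + p * y = v 1 := by rw [hx, hy]; field_simp; ring
  have m00 := hentry 0 0
  have m01 := hentry 0 1
  have m02 := hentry 0 2
  have m10 := hentry 1 0
  have m11 := hentry 1 1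
  have m12 := hentry 1 2
  have m20 := hentry 2 0
  have m21 := hentry 2 1
  have m22 := hentry 2 2
  clear_value x y
  simp at m00 m01 m02 m10 m11 m12 m20 m21 m22
  funext i
  fin_cases i
  · simp [mongeMap, quadMap, quadPoly, targetQuad, g2, hX]
  · simp [mongeMap, quadMap, quadPoly, targetQuad, g2, ← hY]
  · simp [mongeMap, quadMap, quadPoly, targetQuad, g2, k]
    set z := v 2 - (a * x + b * y) / 2 with hz
    have hv : v 2 = z + (a * x + b * y) / 2 := by rw [hz]; ring
    rw [hv]
    linear_combination z ^ 2 * m00 + x * z * m01 + y * z * m02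
  · simp [mongeMap, quadMap, quadPoly, targetQuad, g2, k]
    set z := v 2 - (a * x + b * y) / 2 with hz
    have hv : v 2 = z + (a * x + b * y) / 2 := by rw [hz]; ring
    rw [hv, ← hX]
    linear_combination z ^ 2 * m10 + x * z * m11 + y * z * m12
  · simp [mongeMap, quadMap, quadPoly, targetQuad, g2, k]
    set z := v 2 - (a * x + b * y) / 2 with hz
    linear_combination z ^ 2 * m20 + x * z * m21 + y * z * m22

/-- A corank 1 map in Monge form is `𝒜²`-equivalent to `(x,y,z²,xz,0)` iff the
coefficient matrix `α` of `z², xz, yz` has determinant zero, rank two, and nonzero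
first column (the `z²`-coefficients). -/
theorem A2_equiv_g2_iff
    (c : Fin 3 → Fin 3 → ℝ) (α : Matrix (Fin 3) (Fin 3) ℝ)
    (Q : Fin 3 → (Fin 3 → ℝ) → ℝ)
    (hQ : ∀ i p, Q i p = c i 0 * p 0 ^ 2 + c i 1 * p 0 * p 1 + c i 2 * p 1 ^ 2
        + α i 0 * p 2 ^ 2 + α i 1 * p 0 * p 2 + α i 2 * p 1 * p 2)
    (f : (Fin 3 → ℝ) → (Fin 5 → ℝ))
    (hf : ∀ p, f p = ![p 0, p 1, Q 0 p, Q 1 p, Q 2 p]) :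
    A2Equiv f g2 ↔ (α.det = 0 ∧ α.rank = 2 ∧ ∃ i, α i 0 ≠ 0) := by
  have hfK : f = mongeMap fun i => ![c i 0, c i 1, c i 2, α i 0, α i 1, α i 2] := by
    funext p i
    rw [hf]
    fin_cases i <;> simp [hQ, mongeMap, quadMap, quadPoly]
  have hα (i : Fin 3) : ![α i 0, α i 1, α i 2] = α i := by
    funext j
    fin_cases j <;> rfl
  rw [hfK]
  exact ⟨fun h => h.det_rank_of_mongeMap α hα,
    fun ⟨hdet, hrank, h0⟩ => A2Equiv.mongeMap_g2 α hα hdet hrank h0⟩
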